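/- Let σ > 0 and let p : ℝ^d → ℝ be a nonnegative Lebesgue-integrable function with ∫ p(y) dy > 0. Define the Gaussian density φ_σ(u) = (2πσ²)^(-d/2) exp(-‖u‖²/(2σ²)) and the smoothed density p_σ(x) = ∫ p(y) φ_σ(x - y) dy. Then p_σ(x) > 0 for all x, and Tweedie's formula holds: ∇ log p_σ(x) = (1/σ²) ( (∫ y p(y) φ_σ(x - y) dy) / p_σ(x) - x ), i.e., the score of the smoothed density equals (posterior mean minus x) divided by σ². -/

import Mathlib

open MeasureTheory

/-- The isotropic Gaussian density `φ_σ(u) = (2πσ²)^(-d/2) exp(-‖u‖²/(2σ²))` on `ℝ^d`. -/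
noncomputable def gaussDensity (d : ℕ) (σ : ℝ) (u : EuclideanSpace ℝ (Fin d)) : ℝ :=
  (2 * Real.pi * σ ^ 2) ^ (-(d : ℝ) / 2) * Real.exp (-‖u‖ ^ 2 / (2 * σ ^ 2))

/-- The Gaussian smoothing `p_σ(x) = ∫ p(y) φ_σ(x - y) dy`. -/
noncomputable def gaussSmoothed (d : ℕ) (σ : ℝ) (p : EuclideanSpace ℝ (Fin d) → ℝ)
    (x : EuclideanSpace ℝ (Fin d)) : ℝ :=
  ∫ y, p y * gaussDensity d σ (x - y)

section GaussDensity

variable {d : ℕ} {σ : ℝ} {p : EuclideanSpace ℝ (Fin d) → ℝ}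

theorem gaussDensity_pos (hσ : 0 < σ) (u : EuclideanSpace ℝ (Fin d)) :
    0 < gaussDensity d σ u := by
  unfold gaussDensity
  positivity

theorem continuous_gaussDensity : Continuous (gaussDensity d σ) := by
  unfold gaussDensity
  fun_prop

theorem gaussDensity_le (u : EuclideanSpace ℝ (Fin d)) :
    gaussDensity d σ u ≤ (2 * Real.pi * σ ^ 2) ^ (-(d : ℝ) / 2) := by
  refine mul_le_of_le_one_right (by positivity) (Real.exp_le_one_iff.2 ?_)
  rw [neg_div]
  exact neg_nonpos.2 (by positivity)

/-- The function `u ↦ φ_σ(u) u` is bounded. -/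
theorem gaussDensity_mul_norm_le (hσ : 0 < σ) (u : EuclideanSpace ℝ (Fin d)) :
    gaussDensity d σ u * ‖u‖ ≤ (2 * Real.pi * σ ^ 2) ^ (-(d : ℝ) / 2) * σ := by
  unfold gaussDensity
  rw [mul_assoc]
  gcongr
  rw [neg_div, Real.exp_neg, inv_mul_le_iff₀ (Real.exp_pos _), ← div_le_iff₀ hσ]
  have hexp := Real.add_one_le_exp (‖u‖ ^ 2 / (2 * σ ^ 2))
  have hsq : ‖u‖ ^ 2 / (2 * σ ^ 2) = (‖u‖ / σ) ^ 2 / 2 := by field_simp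
  rw [hsq] at hexp ⊢
  nlinarith [sq_nonneg (‖u‖ / σ - 1)]

theorem hasFDerivAt_gaussDensity (u : EuclideanSpace ℝ (Fin d)) :
    HasFDerivAt (gaussDensity d σ) (innerSL ℝ (-((σ ^ 2)⁻¹ * gaussDensity d σ u) • u)) u := by
  have hnorm : HasFDerivAt (fun v : EuclideanSpace ℝ (Fin d) => ‖v‖ ^ 2) (2 • innerSL ℝ u) u :=
    (hasStrictFDerivAt_norm_sq u).hasFDerivAt
  have h := ((hnorm.const_mul (-(2 * σ ^ 2)⁻¹)).exp).const_mul
    ((2 * Real.pi * σ ^ 2) ^ (-(d : ℝ) / 2))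
  have heq : ∀ v : EuclideanSpace ℝ (Fin d),
      -‖v‖ ^ 2 / (2 * σ ^ 2) = -(2 * σ ^ 2)⁻¹ * ‖v‖ ^ 2 := fun v => by ring
  unfold gaussDensity
  simp only [heq]
  refine h.congr_fderiv ?_
  ext v
  simp only [innerSL_apply_apply, inner_smul_left, smul_apply, smul_eq_mul,
    nsmul_eq_mul, conj_trivial]
  simp
  ring

theorem integrable_mul_gaussDensity (hσ : 0 < σ) (hp : Integrable p)
    (x : EuclideanSpace ℝ (Fin d)) : Integrable fun y => p y * gaussDensity d σ (x - y) := by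
  refine hp.mul_bdd (c := (2 * Real.pi * σ ^ 2) ^ (-(d : ℝ) / 2))
    (continuous_gaussDensity.comp (by fun_prop)).aestronglyMeasurable (.of_forall fun y => ?_)
  rw [Real.norm_of_nonneg (gaussDensity_pos hσ _).le]
  exact gaussDensity_le _

theorem norm_mul_gaussDensity_smul_le (hσ : 0 < σ) (x y : EuclideanSpace ℝ (Fin d)) :
    ‖(p y * gaussDensity d σ (x - y)) • (y - x)‖ ≤
      ‖p y‖ * ((2 * Real.pi * σ ^ 2) ^ (-(d : ℝ) / 2) * σ) := by
  rw [norm_smul, norm_mul, mul_assoc, Real.norm_of_nonneg (gaussDensity_pos hσ _).le,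
    norm_sub_rev y x]
  exact mul_le_mul_of_nonneg_left (gaussDensity_mul_norm_le hσ _) (norm_nonneg _)

theorem aestronglyMeasurable_mul_gaussDensity_smul (hσ : 0 < σ) (hp : Integrable p)
    (x : EuclideanSpace ℝ (Fin d)) :
    AEStronglyMeasurable fun y => (p y * gaussDensity d σ (x - y)) • (y - x) :=
  (integrable_mul_gaussDensity hσ hp x).aestronglyMeasurable.smul
    (Continuous.aestronglyMeasurable (by fun_prop))

theorem integrable_mul_gaussDensity_smul_sub (hσ : 0 < σ) (hp : Integrable p)
    (x : EuclideanSpace ℝ (Fin d)) :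
    Integrable fun y => (p y * gaussDensity d σ (x - y)) • (y - x) :=
  (hp.norm.mul_const _).mono' (aestronglyMeasurable_mul_gaussDensity_smul hσ hp x)
    (.of_forall fun y => norm_mul_gaussDensity_smul_le hσ x y)

theorem integrable_mul_gaussDensity_smul (hσ : 0 < σ) (hp : Integrable p)
    (x : EuclideanSpace ℝ (Fin d)) :
    Integrable fun y => (p y * gaussDensity d σ (x - y)) • y := by
  refine ((integrable_mul_gaussDensity_smul_sub hσ hp x).add
    ((integrable_mul_gaussDensity hσ hp x).smul_const x)).congr (.of_forall fun y => ?_)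
  simp [← smul_add]

theorem gaussSmoothed_pos (hσ : 0 < σ) (hp_nonneg : ∀ y, 0 ≤ p y) (hp : Integrable p)
    (hp_pos : 0 < ∫ y, p y) (x : EuclideanSpace ℝ (Fin d)) : 0 < gaussSmoothed d σ p x := by
  have hsupp : (Function.support fun y => p y * gaussDensity d σ (x - y)) =
      Function.support p := by
    ext y
    simp [(gaussDensity_pos hσ _).ne']
  unfold gaussSmoothed
  rw [integral_pos_iff_support_of_nonneg
    (fun y => mul_nonneg (hp_nonneg y) (gaussDensity_pos hσ _).le)
    (integrable_mul_gaussDensity hσ hp x), hsupp]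
  exact (integral_pos_iff_support_of_nonneg hp_nonneg hp).1 hp_pos

theorem hasGradientAt_gaussSmoothed (hσ : 0 < σ) (hp : Integrable p)
    (x : EuclideanSpace ℝ (Fin d)) :
    HasGradientAt (gaussSmoothed d σ p)
      ((σ ^ 2)⁻¹ • ∫ y, (p y * gaussDensity d σ (x - y)) • (y - x)) x := by
  have hV : ∀ z, Integrable fun y =>
      (σ ^ 2)⁻¹ • (p y * gaussDensity d σ (z - y)) • (y - z) := fun z =>
    (integrable_mul_gaussDensity_smul_sub hσ hp z).fun_smul _
  have h := hasFDerivAt_integral_of_dominated_of_fderiv_le (𝕜 := ℝ) (μ := volume)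
    (F := fun z y => p y * gaussDensity d σ (z - y))
    (F' := fun z y => innerSL ℝ ((σ ^ 2)⁻¹ • (p y * gaussDensity d σ (z - y)) • (y - z)))
    (bound := fun y => (σ ^ 2)⁻¹ * (‖p y‖ * ((2 * Real.pi * σ ^ 2) ^ (-(d : ℝ) / 2) * σ)))
    (x₀ := x) (s := Set.univ) Filter.univ_mem
    (.of_forall fun z => (integrable_mul_gaussDensity hσ hp z).aestronglyMeasurable)
    (integrable_mul_gaussDensity hσ hp x)
    ((innerSL ℝ).integrable_comp (hV x)).aestronglyMeasurable
    (.of_forall fun y z _ => ?_) ((hp.norm.mul_const _).const_mul _)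
    (.of_forall fun y z _ => ?_)
  · rw [ContinuousLinearMap.integral_comp_comm _ (hV x), integral_smul] at h
    exact h
  · rw [innerSL_apply_norm, norm_smul, Real.norm_of_nonneg (by positivity)]
    gcongr
    exact norm_mul_gaussDensity_smul_le hσ z y
  · have hz := ((hasFDerivAt_gaussDensity (σ := σ) (z - y)).comp z
      ((hasFDerivAt_id z).sub_const y)).const_mul (p y)
    refine hz.congr_fderiv ?_
    ext v
    simp only [smul_apply, ContinuousLinearMap.comp_apply,
      ContinuousLinearMap.id_apply, innerSL_apply_apply, inner_smul_left, smul_eq_mul,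
      conj_trivial, ← neg_sub z y, inner_neg_left]
    ring

end GaussDensity

/-- Tweedie's formula: For `σ > 0` and `p ≥ 0` Lebesgue-integrable with
`∫ p > 0`, the smoothed density is everywhere positive and its score satisfies
`∇ log p_σ(x) = (1/σ²) ((∫ y p(y) φ_σ(x - y) dy) / p_σ(x) - x)`. -/
theorem stmt_7 {d : ℕ} (σ : ℝ) (hσ : 0 < σ)
    (p : EuclideanSpace ℝ (Fin d) → ℝ) (hp_nonneg : ∀ y, 0 ≤ p y)
    (hp_int : Integrable p) (hp_pos : 0 < ∫ y, p y) :
    ∀ x : EuclideanSpace ℝ (Fin d),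
      0 < gaussSmoothed d σ p x ∧
      gradient (fun z => Real.log (gaussSmoothed d σ p z)) x =
        (σ ^ 2)⁻¹ •
          ((gaussSmoothed d σ p x)⁻¹ • (∫ y, (p y * gaussDensity d σ (x - y)) • y) - x) := by
  intro x
  have hpos := gaussSmoothed_pos hσ hp_nonneg hp_int hp_pos x
  refine ⟨hpos, HasGradientAt.gradient ?_⟩
  have hlog := (hasGradientAt_gaussSmoothed hσ hp_int x).hasFDerivAt.log hpos.ne'
  rw [hasGradientAt_iff_hasFDerivAt]
  refine hlog.congr_fderiv ?_
  have hsub : ∫ y, (p y * gaussDensity d σ (x - y)) • (y - x) =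
      (∫ y, (p y * gaussDensity d σ (x - y)) • y) - gaussSmoothed d σ p x • x := by
    simp_rw [smul_sub]
    rw [integral_sub (integrable_mul_gaussDensity_smul hσ hp_int x)
      ((integrable_mul_gaussDensity hσ hp_int x).smul_const x), integral_smul_const]
    rfl
  rw [hsub, ← map_smul, smul_comm, smul_sub (gaussSmoothed d σ p x)⁻¹, inv_smul_smul₀ hpos.ne']
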